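/- For every ε > 0, there exists a finite set I ⊆ ℝ² with |I| odd such that the yolk radius r of I is strictly positive and the LP yolk radius of I is at most (1/2 + ε)·r. -/

import Mathlib

open scoped RealInnerProductSpace
open Real

noncomputable section

/-- Points of Euclidean space `ℝ^k`. -/
abbrev Pt (k : ℕ) := EuclideanSpace ℝ (Fin k)

/-- `(a, b)` (with `‖a‖ = 1`) is a median hyperplane for the finite set of ideal points `I`:
at least `|I|/2` points are on each closed side. -/
def IsMedianHyperplane {k : ℕ} (I : Finset (Pt k)) (a : Pt k) (b : ℝ) : Prop :=
  ‖a‖ = 1 ∧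
    (I.card : ℝ) / 2 ≤ ((I.filter fun x => ⟪a, x⟫ ≤ b).card : ℝ) ∧
    (I.card : ℝ) / 2 ≤ ((I.filter fun x => b ≤ ⟪a, x⟫).card : ℝ)

/-- A limiting median hyperplane for `I ⊆ ℝ^k` is a median hyperplane containing at least
`k` points of `I`. -/
def IsLimitingMedianHyperplane {k : ℕ} (I : Finset (Pt k)) (a : Pt k) (b : ℝ) : Prop :=
  IsMedianHyperplane I a b ∧ k ≤ (I.filter fun x => ⟪a, x⟫ = b).card

/-- The yolk radius: infimum of `r ≥ 0` such that some closed ball `B(c,r)` intersects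
every median hyperplane of `I` (the ball `B(c,r)` meets `H(a,b)` iff `|⟪a,c⟫ - b| ≤ r`). -/
def yolkRadius {k : ℕ} (I : Finset (Pt k)) : ℝ :=
  sInf {r : ℝ | 0 ≤ r ∧ ∃ c : Pt k, ∀ a b, IsMedianHyperplane I a b → |⟪a, c⟫ - b| ≤ r}

/-- The LP yolk radius: infimum of `r ≥ 0` such that some closed ball `B(c,r)` intersects
every limiting median hyperplane of `I`. -/
def lpYolkRadius {k : ℕ} (I : Finset (Pt k)) : ℝ :=
  sInf {r : ℝ | 0 ≤ r ∧ ∃ c : Pt k, ∀ a b, IsLimitingMedianHyperplane I a b → |⟪a, c⟫ - b| ≤ r}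

/-- `B(c,r)` is a yolk of `I`: it intersects every median hyperplane, and every closed ball
intersecting every median hyperplane has radius at least `r`. -/
def IsYolk {k : ℕ} (I : Finset (Pt k)) (c : Pt k) (r : ℝ) : Prop :=
  (∀ a b, IsMedianHyperplane I a b → |⟪a, c⟫ - b| ≤ r) ∧
  ∀ (c' : Pt k) (r' : ℝ),
    (∀ a b, IsMedianHyperplane I a b → |⟪a, c'⟫ - b| ≤ r') → r ≤ r'

/-- `B(c,r)` is an LP yolk of `I`: it intersects every limiting median hyperplane, and every
closed ball intersecting every limiting median hyperplane has radius at least `r`. -/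
def IsLPYolk {k : ℕ} (I : Finset (Pt k)) (c : Pt k) (r : ℝ) : Prop :=
  (∀ a b, IsLimitingMedianHyperplane I a b → |⟪a, c⟫ - b| ≤ r) ∧
  ∀ (c' : Pt k) (r' : ℝ),
    (∀ a b, IsLimitingMedianHyperplane I a b → |⟪a, c'⟫ - b| ≤ r') → r ≤ r'

/-- A strict majority of points cannot lie strictly above a median hyperplane. -/
lemma IsMedianHyperplane.exists_inner_le {k : ℕ} {I T : Finset (Pt k)} {a : Pt k} {b : ℝ}
    (h : IsMedianHyperplane I a b) (hT : T ⊆ I) (hcard : I.card < 2 * T.card) :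
    ∃ x ∈ T, ⟪a, x⟫ ≤ b := by
  by_contra! hlt
  have hsub : I.filter (fun x => ⟪a, x⟫ ≤ b) ⊆ I \ T := by
    intro x hx
    rw [Finset.mem_filter] at hx
    exact Finset.mem_sdiff.2 ⟨hx.1, fun hxT => absurd hx.2 (not_le.2 (hlt x hxT))⟩
  have h1 := Finset.card_le_card hsub
  rw [Finset.card_sdiff_of_subset hT] at h1
  have h2 := Finset.card_le_card hT
  have h3 : I.card ≤ 2 * (I.filter fun x => ⟪a, x⟫ ≤ b).card := by
    have := h.2.1
    rify
    linarith
  lia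

lemma IsMedianHyperplane.neg {k : ℕ} {I : Finset (Pt k)} {a : Pt k} {b : ℝ}
    (h : IsMedianHyperplane I a b) : IsMedianHyperplane I (-a) (-b) := by
  refine ⟨by simpa using h.1, ?_, ?_⟩
  · simpa using h.2.2
  · simpa using h.2.1

/-- A strict majority of points cannot lie strictly below a median hyperplane. -/
lemma IsMedianHyperplane.exists_le_inner {k : ℕ} {I T : Finset (Pt k)} {a : Pt k} {b : ℝ}
    (h : IsMedianHyperplane I a b) (hT : T ⊆ I) (hcard : I.card < 2 * T.card) :
    ∃ x ∈ T, b ≤ ⟪a, x⟫ := by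
  simpa using h.neg.exists_inner_le hT hcard

lemma isMedianHyperplane_of_subset {k : ℕ} {I S T : Finset (Pt k)} {a : Pt k} {b : ℝ}
    (ha : ‖a‖ = 1) (hS : S ⊆ I) (hT : T ⊆ I) (hScard : I.card ≤ 2 * S.card)
    (hTcard : I.card ≤ 2 * T.card) (hSb : ∀ x ∈ S, ⟪a, x⟫ ≤ b) (hTb : ∀ x ∈ T, b ≤ ⟪a, x⟫) :
    IsMedianHyperplane I a b := by
  have h1 : S.card ≤ (I.filter fun x => ⟪a, x⟫ ≤ b).card :=
    Finset.card_le_card fun x hx => Finset.mem_filter.2 ⟨hS hx, hSb x hx⟩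
  have h2 : T.card ≤ (I.filter fun x => b ≤ ⟪a, x⟫).card :=
    Finset.card_le_card fun x hx => Finset.mem_filter.2 ⟨hT hx, hTb x hx⟩
  rify at h1 h2 hScard hTcard
  exact ⟨ha, by linarith, by linarith⟩

lemma IsMedianHyperplane.abs_le_sum_norm {k : ℕ} {I : Finset (Pt k)} {a : Pt k} {b : ℝ}
    (h : IsMedianHyperplane I a b) (hI : I.Nonempty) : |b| ≤ ∑ x ∈ I, ‖x‖ := by
  have hcard : I.card < 2 * I.card := by
    have := hI.card_pos
    lia
  have key : ∀ x ∈ I, |⟪a, x⟫| ≤ ∑ x ∈ I, ‖x‖ := fun x hx => by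
    have h1 := abs_real_inner_le_norm a x
    rw [h.1, one_mul] at h1
    exact h1.trans (Finset.single_le_sum (fun y _ => norm_nonneg y) hx)
  obtain ⟨x, hx, hxb⟩ := h.exists_inner_le subset_rfl hcard
  obtain ⟨y, hy, hyb⟩ := h.exists_le_inner subset_rfl hcard
  exact abs_le.2 ⟨by linarith [(abs_le.1 (key x hx)).1], by linarith [(abs_le.1 (key y hy)).2]⟩

lemma le_yolkRadius {k : ℕ} {I : Finset (Pt k)} (hI : I.Nonempty) {ρ : ℝ}
    (h : ∀ (c : Pt k) (r : ℝ), (∀ a b, IsMedianHyperplane I a b → |⟪a, c⟫ - b| ≤ r) → ρ ≤ r) :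
    ρ ≤ yolkRadius I := by
  refine le_csInf ⟨∑ x ∈ I, ‖x‖, Finset.sum_nonneg fun x _ => norm_nonneg x, 0, ?_⟩ ?_
  · intro a b hab
    simpa using hab.abs_le_sum_norm hI
  · rintro r ⟨-, c, hc⟩
    exact h c r hc

lemma lpYolkRadius_le {k : ℕ} {I : Finset (Pt k)} {r : ℝ} (hr : 0 ≤ r) (c : Pt k)
    (h : ∀ a b, IsLimitingMedianHyperplane I a b → |⟪a, c⟫ - b| ≤ r) : lpYolkRadius I ≤ r :=
  csInf_le ⟨0, fun _ hs => hs.1⟩ ⟨hr, c, h⟩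

lemma inner_vec_two (a : Pt 2) (x y : ℝ) : ⟪a, !₂[x, y]⟫ = a 0 * x + a 1 * y := by
  simp [PiLp.inner_apply, Fin.sum_univ_two, mul_comm]

lemma norm_eq_one_iff_sq_add_sq (a : Pt 2) : ‖a‖ = 1 ↔ a 0 ^ 2 + a 1 ^ 2 = 1 := by
  rw [EuclideanSpace.norm_eq, Real.sqrt_eq_one, Fin.sum_univ_two]
  simp

lemma vec_two_ne_of_fst {x y x' y' : ℝ} (h : x ≠ x') : (!₂[x, y] : Pt 2) ≠ !₂[x', y'] :=
  fun H => h (by simpa using congrArg (fun v : Pt 2 => v 0) H)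

lemma vec_two_ne_of_snd {x y x' y' : ℝ} (h : y ≠ y') : (!₂[x, y] : Pt 2) ≠ !₂[x', y'] :=
  fun H => h (by simpa using congrArg (fun v : Pt 2 => v 1) H)

/-- Five points, three of them on the first axis, such that the limiting median lines all meet the
unit disc, while the median lines through `(L, 0)` force the yolk away from it. -/
def yolkExample (L : ℝ) : Finset (Pt 2) :=
  {!₂[L, 0], !₂[-L, 0], !₂[-2 * L, 0], !₂[L ^ 2, -(L - 1)], !₂[L ^ 2, L - 1]}

section yolkExample

variable {L : ℝ}

lemma card_yolkExample (hL : 1 < L) : (yolkExample L).card = 5 := by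
  have h2 : L < L ^ 2 := by nlinarith
  unfold yolkExample
  repeat rw [Finset.card_insert_of_notMem]
  · simp
  · rw [Finset.mem_singleton]
    exact vec_two_ne_of_snd (by linarith)
  · simp only [Finset.mem_insert, Finset.mem_singleton, not_or]
    exact ⟨vec_two_ne_of_fst (by linarith), vec_two_ne_of_fst (by linarith)⟩
  · simp only [Finset.mem_insert, Finset.mem_singleton, not_or]
    exact ⟨vec_two_ne_of_fst (by linarith), vec_two_ne_of_fst (by linarith),
      vec_two_ne_of_fst (by linarith)⟩
  · simp only [Finset.mem_insert, Finset.mem_singleton, not_or]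
    exact ⟨vec_two_ne_of_fst (by linarith), vec_two_ne_of_fst (by linarith),
      vec_two_ne_of_fst (by linarith), vec_two_ne_of_fst (by linarith)⟩

lemma IsMedianHyperplane.exists_le_of_yolkExample {a : Pt 2} {b : ℝ} (hL : 1 < L)
    (h : IsMedianHyperplane (yolkExample L) a b) {x y z : Pt 2} (hx : x ∈ yolkExample L)
    (hy : y ∈ yolkExample L) (hz : z ∈ yolkExample L) (hxy : x ≠ y) (hxz : x ≠ z) (hyz : y ≠ z) :
    (⟪a, x⟫ ≤ b ∨ ⟪a, y⟫ ≤ b ∨ ⟪a, z⟫ ≤ b) ∧ (b ≤ ⟪a, x⟫ ∨ b ≤ ⟪a, y⟫ ∨ b ≤ ⟪a, z⟫) := by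
  have hT : ({x, y, z} : Finset (Pt 2)) ⊆ yolkExample L := by
    simp [Finset.insert_subset_iff, hx, hy, hz]
  have hcard : (yolkExample L).card < 2 * ({x, y, z} : Finset (Pt 2)).card := by
    rw [card_yolkExample hL, Finset.card_eq_three.2 ⟨x, y, z, hxy, hxz, hyz, rfl⟩]
    norm_num
  exact ⟨by simpa using h.exists_inner_le hT hcard, by simpa using h.exists_le_inner hT hcard⟩

lemma isMedianHyperplane_yolkExample {a x y z x' y' z' : Pt 2} {b : ℝ} (hL : 1 < L)
    (ha : ‖a‖ = 1) (hS : {x, y, z} ⊆ yolkExample L) (hT : {x', y', z'} ⊆ yolkExample L)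
    (hxy : x ≠ y) (hxz : x ≠ z) (hyz : y ≠ z) (hxy' : x' ≠ y') (hxz' : x' ≠ z') (hyz' : y' ≠ z')
    (hx : ⟪a, x⟫ ≤ b) (hy : ⟪a, y⟫ ≤ b) (hz : ⟪a, z⟫ ≤ b)
    (hx' : b ≤ ⟪a, x'⟫) (hy' : b ≤ ⟪a, y'⟫) (hz' : b ≤ ⟪a, z'⟫) :
    IsMedianHyperplane (yolkExample L) a b := by
  refine isMedianHyperplane_of_subset ha hS hT ?_ ?_ (by simp [hx, hy, hz]) (by simp [*])
  · rw [card_yolkExample hL, Finset.card_eq_three.2 ⟨x, y, z, hxy, hxz, hyz, rfl⟩]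
    norm_num
  · rw [card_yolkExample hL, Finset.card_eq_three.2 ⟨x', y', z', hxy', hxz', hyz', rfl⟩]
    norm_num

lemma abs_le_one_of_isLimitingMedianHyperplane_yolkExample {a : Pt 2} {b : ℝ} (hL : 1 < L)
    (h : IsLimitingMedianHyperplane (yolkExample L) a b) : |b| ≤ 1 := by
  have h2 : L < L ^ 2 := by nlinarith
  have ha := (norm_eq_one_iff_sq_add_sq a).1 h.1.1
  have hleft := h.1.exists_le_of_yolkExample hL (x := !₂[L, 0]) (y := !₂[-L, 0])
    (z := !₂[-2 * L, 0]) (by simp [yolkExample]) (by simp [yolkExample]) (by simp [yolkExample])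
    (vec_two_ne_of_fst (by linarith)) (vec_two_ne_of_fst (by linarith))
    (vec_two_ne_of_fst (by linarith))
  have hbot := h.1.exists_le_of_yolkExample hL (x := !₂[L, 0]) (y := !₂[-L, 0])
    (z := !₂[L ^ 2, -(L - 1)])
    (by simp [yolkExample]) (by simp [yolkExample]) (by simp [yolkExample])
    (vec_two_ne_of_fst (by linarith)) (vec_two_ne_of_fst (by linarith))
    (vec_two_ne_of_fst (by linarith))
  have htop := h.1.exists_le_of_yolkExample hL (x := !₂[L, 0]) (y := !₂[-L, 0])
    (z := !₂[L ^ 2, L - 1])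
    (by simp [yolkExample]) (by simp [yolkExample]) (by simp [yolkExample])
    (vec_two_ne_of_fst (by linarith)) (vec_two_ne_of_fst (by linarith))
    (vec_two_ne_of_fst (by linarith))
  obtain ⟨x, hx, y, hy, hxy⟩ := Finset.one_lt_card.1 h.2
  rw [Finset.mem_filter] at hx hy
  obtain ⟨hxI, hxb⟩ := hx
  obtain ⟨hyI, hyb⟩ := hy
  obtain ⟨p, hp⟩ : ∃ p, a 0 = p := ⟨_, rfl⟩
  obtain ⟨q, hq⟩ : ∃ q, a 1 = q := ⟨_, rfl⟩
  rw [hp, hq] at ha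
  simp only [inner_vec_two, hp, hq] at hleft hbot htop
  simp only [yolkExample, Finset.mem_insert, Finset.mem_singleton] at hxI hyI
  have of_zero : p = 0 → p * L = -b ∨ p * L = b ∨ p * (2 * L) = -b ∨ p * L ^ 2 = b → |b| ≤ 1 := by
    rintro rfl hb
    have : b = 0 := by rcases hb with hb | hb | hb | hb <;> linarith
    simp [this]
  have right_apex : ∀ t, t ^ 2 = (L - 1) ^ 2 → p * L + q * 0 = b → p * L ^ 2 + q * t = b →
      |b| ≤ 1 := by
    intro t ht h1 h2
    rw [← sq_le_one_iff_abs_le_one]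
    have hqt : q * t = -(b * (L - 1)) := by linear_combination h2 - L * h1
    have h3 : q ^ 2 * (L - 1) ^ 2 = b ^ 2 * (L - 1) ^ 2 := by
      linear_combination (q * t - b * (L - 1)) * hqt - q ^ 2 * ht
    have h4 : q ^ 2 = b ^ 2 := mul_right_cancel₀ (pow_ne_zero 2 (by linarith)) h3
    nlinarith [sq_nonneg p]
  have left_apex : ∀ t, t ^ 2 = (L - 1) ^ 2 → p * -L + q * 0 = b → p * L ^ 2 + q * t = b →
      |b| ≤ 1 := by
    intro t ht h1 h2
    rw [← sq_le_one_iff_abs_le_one]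
    have hqt : q * t = b * (L + 1) := by linear_combination h2 + L * h1
    have h3 : q ^ 2 * (L - 1) ^ 2 = b ^ 2 * (L + 1) ^ 2 := by
      linear_combination (q * t + b * (L + 1)) * hqt - q ^ 2 * ht
    have h4 : b ^ 2 * (L - 1) ^ 2 ≤ q ^ 2 * (L - 1) ^ 2 := by
      rw [h3]
      gcongr
      linarith
    have h5 : b ^ 2 ≤ q ^ 2 := le_of_mul_le_mul_right h4 (by nlinarith)
    nlinarith [sq_nonneg p]
  have far_left : ∀ t, (t = L - 1 ∨ t = -(L - 1)) → p * (-2 * L) + q * 0 = b →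
      p * L ^ 2 + q * t = b → |b| ≤ 1 := by
    intro t ht h1 h2
    rcases lt_trichotomy p 0 with hp | hp | hp
    · exfalso
      have : p * L < 0 := by nlinarith
      have : p * L ^ 2 < 0 := by nlinarith
      rcases ht with rfl | rfl
      · rcases hbot.2 with h | h | h <;> linarith
      · rcases htop.2 with h | h | h <;> linarith
    · exact of_zero hp (by right; right; left; linarith)
    · exfalso
      have : 0 < p * L := by nlinarith
      have : 0 < p * L ^ 2 := by nlinarith
      rcases ht with rfl | rfl
      · rcases hbot.1 with h | h | h <;> linarith
      · rcases htop.1 with h | h | h <;> linarith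
  have vertical : p * L ^ 2 + q * -(L - 1) = b → p * L ^ 2 + q * (L - 1) = b → |b| ≤ 1 := by
    intro h1 h2
    have h3 : q * (L - 1) = 0 := by linarith
    rcases lt_trichotomy p 0 with hp | hp | hp
    · exfalso
      have : p * L < 0 := by nlinarith
      have : p * L ^ 2 < p * L := by nlinarith
      rcases hleft.1 with h | h | h <;> linarith
    · exact of_zero hp (by right; right; right; linarith)
    · exfalso
      have : 0 < p * L := by nlinarith
      have : p * L < p * L ^ 2 := by nlinarith
      rcases hleft.2 with h | h | h <;> linarith
  have axis : ∀ s t, s ≠ t → p * s + q * 0 = b → p * t + q * 0 = b → |b| ≤ 1 := by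
    intro s t hst h1 h2
    have hp : p = 0 := by
      have : p * (s - t) = 0 := by linarith
      exact (mul_eq_zero.1 this).resolve_right (sub_ne_zero.2 hst)
    subst hp
    exact of_zero rfl (by right; left; linarith)
  rcases hxI with rfl | rfl | rfl | rfl | rfl <;> rcases hyI with rfl | rfl | rfl | rfl | rfl <;>
    rw [inner_vec_two, hp, hq] at hxb hyb <;>
    first
    | exact absurd rfl hxy
    | exact vertical hxb hyb
    | exact vertical hyb hxb
    | exact right_apex _ (by ring) hxb hyb
    | exact right_apex _ (by ring) hyb hxb
    | exact left_apex _ (by ring) hxb hyb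
    | exact left_apex _ (by ring) hyb hxb
    | exact far_left _ (by simp) hxb hyb
    | exact far_left _ (by simp) hyb hxb
    | exact axis _ _ (fun H => by linarith) hxb hyb

end yolkExample

lemma le_yolkRadius_yolkExample {L : ℝ} (hL : 1 < L) :
    2 * L * (L - 1) / (L ^ 2 + 3 * L - 2) ≤ yolkRadius (yolkExample L) := by
  have h2 : L < L ^ 2 := by nlinarith
  refine le_yolkRadius (Finset.card_pos.1 (by rw [card_yolkExample hL]; norm_num)) ?_
  intro c r hc
  set D := √((L - 1) ^ 2 + (L ^ 2 + L) ^ 2) with hD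
  have hDsq : D ^ 2 = (L - 1) ^ 2 + (L ^ 2 + L) ^ 2 := Real.sq_sqrt (by positivity)
  have hDpos : 0 < D := Real.sqrt_pos.2 (by nlinarith [sq_nonneg (L - 1)])
  have hDle : D ≤ (L - 1) + (L ^ 2 + L) := by
    refine (abs_le_of_sq_le_sq' ?_ (by nlinarith)).2
    nlinarith
  have hnorm : ((L - 1) / D) ^ 2 + ((L ^ 2 + L) / D) ^ 2 = 1 := by
    rw [div_pow, div_pow, ← add_div, ← hDsq, div_self (by positivity)]
  have h_axis := hc !₂[1, 0] L <| isMedianHyperplane_yolkExample hL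
    (x := !₂[L, 0]) (y := !₂[-L, 0]) (z := !₂[-2 * L, 0])
    (x' := !₂[L, 0]) (y' := !₂[L ^ 2, -(L - 1)]) (z' := !₂[L ^ 2, L - 1])
    (by simp [norm_eq_one_iff_sq_add_sq])
    (by simp [yolkExample, Finset.insert_subset_iff])
    (by simp [yolkExample, Finset.insert_subset_iff])
    (vec_two_ne_of_fst (by linarith)) (vec_two_ne_of_fst (by linarith))
    (vec_two_ne_of_fst (by linarith)) (vec_two_ne_of_fst (by linarith))
    (vec_two_ne_of_fst (by linarith)) (vec_two_ne_of_snd (by linarith))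
    (by simp [inner_vec_two]) (by simp [inner_vec_two]; linarith)
    (by simp [inner_vec_two]; linarith) (by simp [inner_vec_two])
    (by simp [inner_vec_two]; linarith) (by simp [inner_vec_two]; linarith)
  have h_down := hc !₂[(L - 1) / D, (L ^ 2 + L) / D] (-(L * (L - 1) / D)) <|
    isMedianHyperplane_yolkExample hL
    (x := !₂[-L, 0]) (y := !₂[-2 * L, 0]) (z := !₂[L ^ 2, -(L - 1)])
    (x' := !₂[L, 0]) (y' := !₂[-L, 0]) (z' := !₂[L ^ 2, L - 1])
    (by simpa [norm_eq_one_iff_sq_add_sq] using hnorm)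
    (by simp [yolkExample, Finset.insert_subset_iff])
    (by simp [yolkExample, Finset.insert_subset_iff])
    (vec_two_ne_of_fst (by linarith)) (vec_two_ne_of_fst (by linarith))
    (vec_two_ne_of_fst (by linarith)) (vec_two_ne_of_fst (by linarith))
    (vec_two_ne_of_fst (by linarith)) (vec_two_ne_of_fst (by linarith))
    (by simp [inner_vec_two]; field_simp; nlinarith)
    (by simp [inner_vec_two]; field_simp; nlinarith)
    (by simp [inner_vec_two]; field_simp; nlinarith)
    (by simp [inner_vec_two]; field_simp; nlinarith)
    (by simp [inner_vec_two]; field_simp; nlinarith)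
    (by simp [inner_vec_two]; field_simp; nlinarith)
  have h_up := hc !₂[(L - 1) / D, -((L ^ 2 + L) / D)] (-(L * (L - 1) / D)) <|
    isMedianHyperplane_yolkExample hL
    (x := !₂[-L, 0]) (y := !₂[-2 * L, 0]) (z := !₂[L ^ 2, L - 1])
    (x' := !₂[L, 0]) (y' := !₂[-L, 0]) (z' := !₂[L ^ 2, -(L - 1)])
    (by simpa [norm_eq_one_iff_sq_add_sq] using hnorm)
    (by simp [yolkExample, Finset.insert_subset_iff])
    (by simp [yolkExample, Finset.insert_subset_iff])
    (vec_two_ne_of_fst (by linarith)) (vec_two_ne_of_fst (by linarith))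
    (vec_two_ne_of_fst (by linarith)) (vec_two_ne_of_fst (by linarith))
    (vec_two_ne_of_fst (by linarith)) (vec_two_ne_of_fst (by linarith))
    (by simp [inner_vec_two]; field_simp; nlinarith)
    (by simp [inner_vec_two]; field_simp; nlinarith)
    (by simp [inner_vec_two]; field_simp; nlinarith)
    (by simp [inner_vec_two]; field_simp; nlinarith)
    (by simp [inner_vec_two]; field_simp; nlinarith)
    (by simp [inner_vec_two]; field_simp; nlinarith)
  have hr : 0 ≤ r := (abs_nonneg _).trans h_axis
  have hinner : ∀ x y : ℝ, ⟪!₂[x, y], c⟫ = x * c 0 + y * c 1 := fun x y => by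
    rw [real_inner_comm, inner_vec_two]
    ring
  rw [hinner] at h_axis h_down h_up
  have hfst := (abs_le.1 h_axis).1
  have hsum : (L - 1) * (c 0 + L) / D ≤ r := by
    have h3 := (abs_le.1 h_down).2
    have h4 := (abs_le.1 h_up).2
    have : (L - 1) * (c 0 + L) / D = (L - 1) / D * c 0 + L * (L - 1) / D := by ring
    linarith
  rw [div_le_iff₀ hDpos] at hsum
  rw [div_le_iff₀ (by nlinarith)]
  have h5 : (L - 1) * (2 * L - r) ≤ (L - 1) * (c 0 + L) :=
    mul_le_mul_of_nonneg_left (by linarith) (by linarith)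
  have h6 : r * D ≤ r * ((L - 1) + (L ^ 2 + L)) := mul_le_mul_of_nonneg_left hDle hr
  linarith

/-- For every `ε > 0`, there is a finite `I ⊆ ℝ²` with `|I|` odd and
strictly positive yolk radius whose LP yolk radius is at most `(1/2 + ε)` times its
yolk radius. -/
theorem lp_yolk_half_ratio_attained (ε : ℝ) (hε : 0 < ε) :
    ∃ I : Finset (Pt 2), Odd I.card ∧ 0 < yolkRadius I ∧
      lpYolkRadius I ≤ (1 / 2 + ε) * yolkRadius I := by
  obtain ⟨L, hL, hLε⟩ : ∃ L : ℝ, 1 < L ∧ 2 ≤ ε * (L - 1) :=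
    ⟨2 + 2 / ε, by linarith [div_pos two_pos hε], by field_simp; linarith⟩
  have hden : 0 < L ^ 2 + 3 * L - 2 := by nlinarith
  have hyolk := le_yolkRadius_yolkExample hL
  refine ⟨yolkExample L, by rw [card_yolkExample hL]; decide, ?_, ?_⟩
  · exact lt_of_lt_of_le (div_pos (by nlinarith) hden) hyolk
  · calc lpYolkRadius (yolkExample L) ≤ 1 := lpYolkRadius_le zero_le_one 0 fun a b hab => by
          simpa using abs_le_one_of_isLimitingMedianHyperplane_yolkExample hL hab
      _ ≤ (1 / 2 + ε) * (2 * L * (L - 1) / (L ^ 2 + 3 * L - 2)) := by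
          rw [← mul_div_assoc, le_div_iff₀ hden]
          nlinarith
      _ ≤ _ := by gcongr
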